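/- For every n ≥ 1, the nonnegative rank of the unique disjointness matrix satisfies rank_+(UDISJ(n)) ≥ (3/2)^n. -/

import Mathlib

/-- Bit strings of length `n`. -/
abbrev BitStr (n : ℕ) : Type := Fin n → Bool

/-- The inner product `aᵀb = Σᵢ aᵢbᵢ` of two bit strings (a natural number;
its value over `ℝ` is obtained by coercion). -/
def bitIP {n : ℕ} (a b : BitStr n) : ℕ := ∑ i, if a i && b i then 1 else 0

/-- The unique disjointness matrix `UDISJ(n)_{a,b} = (1 - aᵀb)²`. -/
noncomputable def UDISJ (n : ℕ) : Matrix (BitStr n) (BitStr n) ℝ :=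
  Matrix.of fun a b => (1 - (bitIP a b : ℝ)) ^ 2

theorem sum_bitStr_succ {M : Type*} [AddCommMonoid M] {n : ℕ} (f : BitStr (n + 1) → M) :
    ∑ a, f a = ∑ a : BitStr n, (f (Fin.cons false a) + f (Fin.cons true a)) := by
  rw [← (Fin.consEquiv fun _ : Fin (n + 1) => Bool).sum_comp, Fintype.sum_prod_type,
    Fintype.sum_bool, add_comm, ← Finset.sum_add_distrib]
  rfl

theorem bitIP_cons {n : ℕ} (s t : Bool) (a b : BitStr n) :
    bitIP (Fin.cons s a : BitStr (n + 1)) (Fin.cons t b) =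
      (if s && t then 1 else 0) + bitIP a b := by
  rw [bitIP, Fin.sum_univ_succ]
  rfl

/-- There are `3 ^ n` pairs of disjoint bit strings. -/
theorem sum_disjoint_pairs (n : ℕ) :
    ∑ a : BitStr n, ∑ b : BitStr n, (if bitIP a b = 0 then 1 else 0) = 3 ^ n := by
  induction n with
  | zero => simp [bitIP]
  | succ n ih =>
    rw [pow_succ, ← ih, Finset.sum_mul, sum_bitStr_succ]
    refine Finset.sum_congr rfl fun a _ => ?_
    rw [sum_bitStr_succ, sum_bitStr_succ, ← Finset.sum_add_distrib, Finset.sum_mul]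
    refine Finset.sum_congr rfl fun b _ => ?_
    simp only [bitIP_cons]
    by_cases h : bitIP a b = 0 <;> simp [h]

/-- A combinatorial rectangle without a pair of inner product `1` contains at most `2 ^ n`
disjoint pairs. -/
theorem sum_disjoint_pairs_rectangle_le (n : ℕ) (A B : BitStr n → Bool)
    (h : ∀ a b, A a → B b → bitIP a b ≠ 1) :
    ∑ a, ∑ b, (if bitIP a b = 0 ∧ A a ∧ B b then 1 else 0) ≤ 2 ^ n := by
  induction n with
  | zero =>
    simp only [Finset.univ_unique, Finset.sum_singleton, pow_zero]
    split_ifs <;> simp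
  | succ n ih =>
    let A₀ : BitStr n → Bool := fun a => A (Fin.cons false a)
    let A₁ : BitStr n → Bool := fun a => A (Fin.cons true a)
    let B₀ : BitStr n → Bool := fun b => B (Fin.cons false b)
    let B₁ : BitStr n → Bool := fun b => B (Fin.cons true b)
    have h₁ := ih (fun a => A₀ a || A₁ a) B₀ fun a b ha hb => by
      rcases Bool.or_eq_true_iff.mp ha with ha | ha
      · simpa [bitIP_cons] using h _ _ ha hb
      · simpa [bitIP_cons] using h _ _ ha hb
    have h₂ := ih A₀ (fun b => B₀ b || B₁ b) fun a b ha hb => by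
      rcases Bool.or_eq_true_iff.mp hb with hb | hb
      · simpa [bitIP_cons] using h _ _ ha hb
      · simpa [bitIP_cons] using h _ _ ha hb
    have h₃ : ∀ a b, A₁ a → B₁ b → bitIP a b ≠ 0 := fun a b ha hb => by
      simpa [bitIP_cons] using h _ _ ha hb
    rw [pow_succ, mul_two]
    refine le_trans ?_ (add_le_add h₁ h₂)
    rw [sum_bitStr_succ, ← Finset.sum_add_distrib]
    refine Finset.sum_le_sum fun a _ => ?_
    rw [sum_bitStr_succ, sum_bitStr_succ, ← Finset.sum_add_distrib, ← Finset.sum_add_distrib]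
    refine Finset.sum_le_sum fun b _ => ?_
    have hab := h₃ a b
    simp only [bitIP_cons]
    by_cases h0 : bitIP a b = 0
    · cases ha₀ : A (Fin.cons false a) <;> cases ha₁ : A (Fin.cons true a) <;>
        cases hb₀ : B (Fin.cons false b) <;> cases hb₁ : B (Fin.cons true b) <;>
        simp_all [A₀, A₁, B₀, B₁]
    · simp [h0]

/-- For every `n ≥ 1`, `rank₊(UDISJ(n)) ≥ (3/2)^n`: any nonnegative factorization
`UDISJ(n)_{a,b} = ⟨x_a, y_b⟩` with `x_a, y_b ∈ ℝ^r₊` satisfies `r ≥ (3/2)^n`. -/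
theorem nonneg_rank_udisj_lower_bound (n : ℕ) (hn : 1 ≤ n) (r : ℕ)
    (x y : BitStr n → (Fin r → ℝ))
    (hx : ∀ a i, 0 ≤ x a i) (hy : ∀ b i, 0 ≤ y b i)
    (hfact : ∀ a b, UDISJ n a b = ∑ i, x a i * y b i) :
    ((3 : ℝ) / 2) ^ n ≤ (r : ℝ) := by
  have hrect (i : Fin r) := sum_disjoint_pairs_rectangle_le n
    (fun a => decide (0 < x a i)) (fun b => decide (0 < y b i)) fun a b ha hb hab => by
      have hpos : 0 < x a i * y b i := mul_pos (of_decide_eq_true ha) (of_decide_eq_true hb)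
      have hle := Finset.single_le_sum (f := fun j => x a j * y b j)
        (fun j _ => mul_nonneg (hx a j) (hy b j)) (Finset.mem_univ i)
      have hzero : UDISJ n a b = 0 := by simp [UDISJ, hab]
      rw [← hfact, hzero] at hle
      exact hpos.not_ge hle
  have hcover (a b : BitStr n) : (if bitIP a b = 0 then 1 else 0) ≤
      ∑ i, (if bitIP a b = 0 ∧ decide (0 < x a i) ∧ decide (0 < y b i) then 1 else 0) := by
    split_ifs with hab
    · have hone : ∑ i, x a i * y b i = 1 := by rw [← hfact]; simp [UDISJ, hab]
      obtain ⟨i, -, hi⟩ := Finset.exists_ne_zero_of_sum_ne_zero (hone.trans_ne one_ne_zero)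
      have hxi := (hx a i).lt_of_ne' (left_ne_zero_of_mul hi)
      have hyi := (hy b i).lt_of_ne' (right_ne_zero_of_mul hi)
      refine le_trans ?_ (Finset.single_le_sum (fun _ _ => Nat.zero_le _) (Finset.mem_univ i))
      simp [hab, hxi, hyi]
    · exact Nat.zero_le _
  have hcount : 3 ^ n ≤ r * 2 ^ n := calc
    3 ^ n = ∑ a : BitStr n, ∑ b : BitStr n, (if bitIP a b = 0 then 1 else 0) :=
      (sum_disjoint_pairs n).symm
    _ ≤ ∑ a, ∑ b, ∑ i,
        (if bitIP a b = 0 ∧ decide (0 < x a i) ∧ decide (0 < y b i) then 1 else 0) :=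
      Finset.sum_le_sum fun a _ => Finset.sum_le_sum fun b _ => hcover a b
    _ = ∑ i, ∑ a, ∑ b,
        (if bitIP a b = 0 ∧ decide (0 < x a i) ∧ decide (0 < y b i) then 1 else 0) := by
      rw [Finset.sum_comm]
      simp_rw [Finset.sum_comm (s := Finset.univ (α := BitStr n))
        (t := Finset.univ (α := Fin r))]
      rw [Finset.sum_congr rfl fun _ _ => Finset.sum_comm]
    _ ≤ ∑ _i : Fin r, 2 ^ n := Finset.sum_le_sum fun i _ => hrect i
    _ = r * 2 ^ n := by simp
  rw [div_pow, div_le_iff₀ (by positivity)]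
  exact_mod_cast hcount
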